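/- arXiv:1305.7418 — 2 statements merged into one kernel-verified Lean document; each statement's English description precedes it below -/
import Mathlib

section
/- Let A be a finite nontrivial multiset of real numbers with drift δ(A) < 0. Then the growth constant of the sequence counting half-line walks on A equals the inventory evaluated at its unique positive critical point: K_A = χ_A(τ_A), where τ_A is the unique positive real number satisfying χ_A'(τ_A) = 0. -/
open scoped BigOperators

/-- `w` is a half-line walk: every partial sum of its steps is nonnegative.
The steps of the (indexed) finite multiset `A` are chosen with multiplicity via the index. -/
def IsHalfLineWalk {ι : Type} (A : ι → ℝ) {n : ℕ} (w : Fin n → ι) : Prop :=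
  ∀ m : Fin n, 0 ≤ ∑ i : Fin n, if i ≤ m then A (w i) else 0

/-- `h_n(A)`: the number of half-line walks of length `n` on the finite multiset `A`. -/
noncomputable def hlineCount {ι : Type} [Fintype ι] (A : ι → ℝ) (n : ℕ) : ℕ :=
  Nat.card {w : Fin n → ι // IsHalfLineWalk A w}

/-- The growth constant `limsup h_n^{1/n}` of a counting sequence. -/
noncomputable def walkGrowth (h : ℕ → ℕ) : ℝ :=
  Filter.limsup (fun n => (h n : ℝ) ^ ((n : ℝ)⁻¹)) Filter.atTop

/-- The inventory `χ_A(u) = ∑_{a ∈ A} u^a` of a finite multiset of reals. -/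
noncomputable def chi {ι : Type} [Fintype ι] (A : ι → ℝ) (u : ℝ) : ℝ :=
  ∑ k, u ^ A k

open Filter Topology Finset

/-! ### The cycle lemma -/

/-- If a periodic sequence has nonnegative sum over one period, then for some starting point within
the period all subsequent partial sums are nonnegative. -/
theorem exists_shift_partialSums_nonneg {n : ℕ} (hn : 0 < n) (a : ℕ → ℝ)
    (hper : ∀ i, a (i + n) = a i) (hsum : 0 ≤ ∑ i ∈ range n, a i) :
    ∃ j < n, ∀ m, 0 ≤ ∑ i ∈ range m, a (j + i) := by
  have hstep : ∀ m, ∑ i ∈ range m, a i ≤ ∑ i ∈ range (m + n), a i := by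
    intro m
    rw [add_comm m n, sum_range_add]
    have : ∀ i, a (n + i) = a i := fun i => by rw [add_comm]; exact hper i
    simp only [this]
    linarith
  obtain ⟨j, hj, hmin⟩ := exists_min_image (range n) (fun m => ∑ i ∈ range m, a i)
    ⟨0, mem_range.2 hn⟩
  have hall : ∀ m, ∑ i ∈ range j, a i ≤ ∑ i ∈ range m, a i := by
    intro m
    induction m using Nat.strong_induction_on with
    | _ m ih =>
      rcases lt_or_ge m n with h | h
      · exact hmin m (mem_range.2 h)
      · have h1 := ih (m - n) (by omega)
        have h2 := hstep (m - n)
        rw [Nat.sub_add_cancel h] at h2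
        exact h1.trans h2
  refine ⟨j, mem_range.1 hj, fun m => ?_⟩
  have := hall (j + m)
  rw [sum_range_add] at this
  linarith

theorem exists_rotation_isHalfLineWalk {ι : Type} (A : ι → ℝ) {n : ℕ} [NeZero n]
    (w : Fin n → ι) (hw : 0 ≤ ∑ i, A (w i)) :
    ∃ j : Fin n, IsHalfLineWalk A (fun i => w (i + j)) := by
  have hn : 0 < n := Nat.pos_of_neZero n
  let a : ℕ → ℝ := fun i => A (w (Fin.ofNat n i))
  have hval : ∀ i : Fin n, a i = A (w i) := by
    intro i
    simp [a]
  obtain ⟨j, hj, hjw⟩ := exists_shift_partialSums_nonneg hn a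
    (fun i => by
      have : Fin.ofNat n (i + n) = Fin.ofNat n i := by
        ext; simp [Fin.ofNat]
      simp only [a, this])
    (by
      rw [← Fin.sum_univ_eq_sum_range]
      simpa only [hval] using hw)
  refine ⟨⟨j, hj⟩, fun m => ?_⟩
  have hterm : ∀ i : Fin n, A (w (i + ⟨j, hj⟩)) = a (j + i) := by
    intro i
    have : i + ⟨j, hj⟩ = Fin.ofNat n (j + i) := by
      ext; simp [Fin.ofNat, Fin.val_add, add_comm]
    simp only [a, this]
  have hm := hjw (m + 1)
  simp only [hterm, Fin.le_def]
  rw [Fin.sum_univ_eq_sum_range (fun i => if i ≤ (m : ℕ) then a (j + i) else 0), ← sum_filter]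
  have : (range n).filter (fun i => i ≤ (m : ℕ)) = range (m + 1) := by
    ext i
    have := m.2
    simp only [mem_filter, mem_range]
    omega
  rwa [this]

open Classical in
theorem card_sum_nonneg_le_mul_hlineCount {ι : Type} [Fintype ι] (A : ι → ℝ) (n : ℕ) [NeZero n] :
    #{w : Fin n → ι | 0 ≤ ∑ i, A (w i)} ≤ n * hlineCount A n := by
  have hex : ∀ w : {w : Fin n → ι // 0 ≤ ∑ i, A (w i)},
      ∃ j : Fin n, IsHalfLineWalk A (fun i => w.1 (i + j)) :=
    fun w => exists_rotation_isHalfLineWalk A w.1 w.2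
  choose j hj using hex
  let F : {w : Fin n → ι // 0 ≤ ∑ i, A (w i)} → Fin n × {w : Fin n → ι // IsHalfLineWalk A w} :=
    fun w => (j w, ⟨_, hj w⟩)
  have hF : Function.Injective F := by
    intro w w' h
    simp only [F, Prod.mk.injEq, Subtype.mk.injEq] at h
    obtain ⟨h1, h2⟩ := h
    apply Subtype.ext
    funext i
    have := congrFun h2 (i - j w)
    rw [← h1] at this
    simpa using this
  have := Nat.card_le_card_of_injective F hF
  rw [Nat.card_prod, Nat.card_fin] at this
  rwa [Nat.card_eq_fintype_card, Fintype.card_subtype] at this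

/-! ### Moments of sums of independent steps -/

theorem sum_prod_eq_pow {ι : Type} [Fintype ι] (p : ι → ℝ) (n : ℕ) :
    ∑ w : Fin n → ι, ∏ i, p (w i) = (∑ k, p k) ^ n := by
  classical
  rw [Fintype.sum_pow]

theorem sum_fin_succ_fun {ι : Type} [Fintype ι] {n : ℕ} (f : (Fin (n + 1) → ι) → ℝ) :
    ∑ w, f w = ∑ k, ∑ w : Fin n → ι, f (Fin.cons k w) := by
  rw [← (Fin.consEquiv (fun _ : Fin (n + 1) => ι)).sum_comp, Fintype.sum_prod_type]
  rfl

theorem sum_prod_mul_sum_eq_zero {ι : Type} [Fintype ι] (p b : ι → ℝ)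
    (hp : ∑ k, p k = 1) (hb : ∑ k, p k * b k = 0) (n : ℕ) :
    ∑ w : Fin n → ι, (∏ i, p (w i)) * ∑ i, b (w i) = 0 := by
  induction n with
  | zero => simp
  | succ n ih =>
    rw [sum_fin_succ_fun]
    have : ∀ k, ∑ w : Fin n → ι, (∏ i, p ((Fin.cons k w : Fin (n + 1) → ι) i)) *
        ∑ i, b ((Fin.cons k w : Fin (n + 1) → ι) i) = p k * b k := by
      intro k
      simp only [Fin.prod_univ_succ, Fin.sum_univ_succ, Fin.cons_zero, Fin.cons_succ]
      have h : ∀ w : Fin n → ι, p k * (∏ i, p (w i)) * (b k + ∑ i, b (w i)) =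
          p k * b k * (∏ i, p (w i)) + p k * ((∏ i, p (w i)) * ∑ i, b (w i)) := fun w => by ring
      simp only [h, sum_add_distrib, ← mul_sum, ih, sum_prod_eq_pow, hp]
      simp
    simp only [this, hb]

theorem sum_prod_mul_sum_sq {ι : Type} [Fintype ι] (p b : ι → ℝ)
    (hp : ∑ k, p k = 1) (hb : ∑ k, p k * b k = 0) (n : ℕ) :
    ∑ w : Fin n → ι, (∏ i, p (w i)) * (∑ i, b (w i)) ^ 2 = n * ∑ k, p k * b k ^ 2 := by
  induction n with
  | zero => simp
  | succ n ih =>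
    rw [sum_fin_succ_fun]
    have : ∀ k, ∑ w : Fin n → ι, (∏ i, p ((Fin.cons k w : Fin (n + 1) → ι) i)) *
        (∑ i, b ((Fin.cons k w : Fin (n + 1) → ι) i)) ^ 2 =
        p k * b k ^ 2 + p k * (n * ∑ k, p k * b k ^ 2) := by
      intro k
      simp only [Fin.prod_univ_succ, Fin.sum_univ_succ, Fin.cons_zero, Fin.cons_succ]
      have h : ∀ w : Fin n → ι, p k * (∏ i, p (w i)) * (b k + ∑ i, b (w i)) ^ 2 =
          p k * b k ^ 2 * (∏ i, p (w i)) + 2 * p k * b k * ((∏ i, p (w i)) * ∑ i, b (w i)) +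
            p k * ((∏ i, p (w i)) * (∑ i, b (w i)) ^ 2) := fun w => by ring
      simp only [h, sum_add_distrib, ← mul_sum, ih, sum_prod_eq_pow, hp,
        sum_prod_mul_sum_eq_zero p b hp hb]
      simp
    simp only [this, sum_add_distrib, ← sum_mul, hp]
    push_cast
    ring

/-! ### Exponential tilting -/

/-- The mean of the step distribution on `A` tilted by `u`. -/
noncomputable def tiltedMean {ι : Type} [Fintype ι] (A : ι → ℝ) (u : ℝ) : ℝ :=
  (∑ k, A k * u ^ A k) / chi A u

theorem chi_pos {ι : Type} [Fintype ι] [Nonempty ι] (A : ι → ℝ) {u : ℝ} (hu : 0 < u) :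
    0 < chi A u :=
  sum_pos (fun _ _ => Real.rpow_pos_of_pos hu _) univ_nonempty

theorem chi_pow_eq {ι : Type} [Fintype ι] (A : ι → ℝ) {u : ℝ} (hu : 0 < u) (n : ℕ) :
    chi A u ^ n = ∑ w : Fin n → ι, u ^ (∑ i, A (w i)) := by
  rw [chi, ← sum_prod_eq_pow]
  exact sum_congr rfl fun w _ => (Real.rpow_sum_of_pos hu _ _).symm

open Classical in
theorem eventually_card_sum_nonneg_ge {ι : Type} [Fintype ι] [Nonempty ι] (A : ι → ℝ) {u : ℝ}
    (hu : 1 ≤ u) (hm : 0 < tiltedMean A u) :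
    ∀ᶠ n : ℕ in atTop, (chi A u * u ^ (-(2 * tiltedMean A u))) ^ n / 2 ≤
      (#{w : Fin n → ι | 0 ≤ ∑ i, A (w i)} : ℝ) := by
  have hu0 : 0 < u := by linarith
  have hχ := chi_pos A hu0
  set m := tiltedMean A u with hmdef
  let p : ι → ℝ := fun k => u ^ A k / chi A u
  let b : ι → ℝ := fun k => A k - m
  have hp : ∑ k, p k = 1 := by
    simp only [p, ← sum_div]
    exact div_self hχ.ne'
  have hpA : ∑ k, p k * A k = m := by
    rw [hmdef, tiltedMean, sum_div]
    exact sum_congr rfl fun k _ => by simp only [p]; ring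
  have hb : ∑ k, p k * b k = 0 := by
    simp only [b, mul_sub, sum_sub_distrib, ← sum_mul, hp, hpA]
    ring
  set v := ∑ k, p k * b k ^ 2 with hv
  have hev : ∀ᶠ n : ℕ in atTop, 2 * v / m ^ 2 ≤ (n : ℝ) :=
    tendsto_natCast_atTop_atTop.eventually_ge_atTop _
  filter_upwards [hev, eventually_gt_atTop 0] with n hn hn0
  have hn0' : (0 : ℝ) < n := by exact_mod_cast hn0
  have hnm : 0 < n * m := mul_pos hn0' hm
  have hprod : ∀ w : Fin n → ι, ∏ i, p (w i) = u ^ (∑ i, A (w i)) / chi A u ^ n := by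
    intro w
    simp only [p, prod_div_distrib, prod_const, card_univ, Fintype.card_fin]
    rw [Real.rpow_sum_of_pos hu0]
  have hsumb : ∀ w : Fin n → ι, ∑ i, b (w i) = ∑ i, A (w i) - n * m := by
    intro w
    simp [b, sum_sub_distrib]
  have hpt : ∀ w : Fin n → ι, ∏ i, p (w i) ≤
      (if 0 ≤ ∑ i, A (w i) then u ^ (2 * (n * m)) / chi A u ^ n else 0) +
        ((∏ i, p (w i)) * (∑ i, b (w i)) ^ 2) / (n * m) ^ 2 := by
    intro w
    have hP : 0 ≤ ∏ i, p (w i) :=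
      prod_nonneg fun i _ => div_nonneg (Real.rpow_nonneg hu0.le _) hχ.le
    by_cases hg : |∑ i, b (w i)| ≤ n * m
    · rw [hsumb, abs_le] at hg
      rw [if_pos (by linarith)]
      have h1 : ∏ i, p (w i) ≤ u ^ (2 * (n * m)) / chi A u ^ n := by
        rw [hprod]
        gcongr
        linarith
      have h2 : 0 ≤ ((∏ i, p (w i)) * (∑ i, b (w i)) ^ 2) / (n * m) ^ 2 := by positivity
      linarith
    · have h1 : ∏ i, p (w i) ≤ ((∏ i, p (w i)) * (∑ i, b (w i)) ^ 2) / (n * m) ^ 2 := by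
        rw [le_div_iff₀ (by positivity)]
        refine mul_le_mul_of_nonneg_left ?_ hP
        rw [← sq_abs (∑ i, b (w i))]
        exact pow_le_pow_left₀ hnm.le (not_le.1 hg).le 2
      have h2 : 0 ≤ (if 0 ≤ ∑ i, A (w i) then u ^ (2 * (n * m)) / chi A u ^ n else 0) := by
        split_ifs <;> positivity
      linarith
  have htot := sum_le_sum fun w (_ : w ∈ (univ : Finset (Fin n → ι))) => hpt w
  rw [sum_prod_eq_pow, hp, one_pow, sum_add_distrib, ← sum_div, sum_prod_mul_sum_sq p b hp hb,
    ← sum_filter, sum_const, nsmul_eq_mul, ← hv] at htot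
  have hhalf : n * v / (n * m) ^ 2 ≤ 1 / 2 := by
    rw [div_le_iff₀ (by positivity)] at hn ⊢
    nlinarith [mul_le_mul_of_nonneg_left hn hn0'.le]
  have hN : 1 / 2 ≤ (#{w : Fin n → ι | 0 ≤ ∑ i, A (w i)} : ℝ) *
      (u ^ (2 * (n * m)) / chi A u ^ n) := by linarith
  have hL : (chi A u * u ^ (-(2 * m))) ^ n = (u ^ (2 * (n * m)) / chi A u ^ n)⁻¹ := by
    rw [mul_pow, ← Real.rpow_mul_natCast hu0.le, inv_div, div_eq_mul_inv, ← Real.rpow_neg hu0.le]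
    congr 2
    ring
  rw [hL, div_eq_mul_inv, inv_mul_le_iff₀ (by positivity), mul_comm]
  simpa using hN

/-! ### The growth constant -/

theorem hlineCount_le_chi_pow {ι : Type} [Fintype ι] (A : ι → ℝ) {u : ℝ} (hu : 1 ≤ u) (n : ℕ) :
    (hlineCount A n : ℝ) ≤ chi A u ^ n := by
  classical
  have hu0 : 0 < u := by linarith
  rw [chi_pow_eq A hu0, hlineCount, Nat.card_eq_fintype_card, Fintype.card_subtype,
    card_eq_sum_ones, sum_filter]
  push_cast
  refine sum_le_sum fun w _ => ?_
  split_ifs with hw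
  · refine Real.one_le_rpow hu ?_
    rcases n with _ | n
    · simp
    · simpa [Fin.le_last] using hw (Fin.last n)
  · positivity

theorem sum_mul_rpow_eq_zero_of_deriv_chi {ι : Type} [Fintype ι] (A : ι → ℝ) {u : ℝ} (hu : 0 < u)
    (h : deriv (chi A) u = 0) : ∑ k, A k * u ^ A k = 0 := by
  have hd : HasDerivAt (chi A) (∑ k, A k * u ^ (A k - 1)) u := by
    unfold chi
    exact HasDerivAt.fun_sum fun k _ => Real.hasDerivAt_rpow_const (Or.inl hu.ne')
  rw [hd.deriv] at h
  have : ∑ k, A k * u ^ A k = u * ∑ k, A k * u ^ (A k - 1) := by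
    rw [mul_sum]
    refine sum_congr rfl fun k _ => ?_
    rw [Real.rpow_sub_one hu.ne']
    field_simp
  rw [this, h, mul_zero]

theorem mul_rpow_self_le {a u v : ℝ} (hu : 0 < u) (huv : u ≤ v) : a * u ^ a ≤ a * v ^ a := by
  rcases le_total 0 a with ha | ha
  · exact mul_le_mul_of_nonneg_left (Real.rpow_le_rpow hu.le huv ha) ha
  · exact mul_le_mul_of_nonpos_left (Real.rpow_le_rpow_of_nonpos hu huv ha) ha

theorem sum_mul_rpow_lt {ι : Type} [Fintype ι] (A : ι → ℝ) (hpos : ∃ k, 0 < A k) {u v : ℝ}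
    (hu : 0 < u) (huv : u < v) : ∑ k, A k * u ^ A k < ∑ k, A k * v ^ A k := by
  obtain ⟨k, hk⟩ := hpos
  exact sum_lt_sum (fun _ _ => mul_rpow_self_le hu huv.le)
    ⟨k, mem_univ k, mul_lt_mul_of_pos_left (Real.rpow_lt_rpow hu.le huv hk) hk⟩

theorem continuousAt_chi {ι : Type} [Fintype ι] (A : ι → ℝ) {u : ℝ} (hu : 0 < u) :
    ContinuousAt (chi A) u := by
  unfold chi
  exact tendsto_finsetSum _ fun k _ => Real.continuousAt_rpow_const u _ (Or.inl hu.ne')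

theorem continuousAt_tiltedMean {ι : Type} [Fintype ι] [Nonempty ι] (A : ι → ℝ) {u : ℝ}
    (hu : 0 < u) : ContinuousAt (tiltedMean A) u := by
  unfold tiltedMean
  refine ContinuousAt.div ?_ (continuousAt_chi A hu) (chi_pos A hu).ne'
  exact tendsto_finsetSum _ fun k _ =>
    (Real.continuousAt_rpow_const u (A k) (Or.inl hu.ne')).const_mul (A k)

theorem eventually_le_hlineCount_rpow {ι : Type} [Fintype ι] [Nonempty ι] (A : ι → ℝ) {u c : ℝ}
    (hu : 1 ≤ u) (hm : 0 < tiltedMean A u) (hc0 : 0 < c)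
    (hc : c < chi A u * u ^ (-(2 * tiltedMean A u))) :
    ∀ᶠ n : ℕ in atTop, c ≤ (hlineCount A n : ℝ) ^ ((n : ℝ)⁻¹) := by
  classical
  set L := chi A u * u ^ (-(2 * tiltedMean A u)) with hL
  have hL0 : 0 < L := hc0.trans hc
  have hlim : Tendsto (fun n : ℕ => (n : ℝ) * (c / L) ^ n) atTop (𝓝 0) :=
    tendsto_self_mul_const_pow_of_lt_one (by positivity) ((div_lt_one hL0).2 hc)
  filter_upwards [eventually_card_sum_nonneg_ge A hu hm, eventually_gt_atTop 0,
    hlim.eventually_le_const (show (0 : ℝ) < 1 / 2 by norm_num)] with n h1 hn h2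
  have : NeZero n := ⟨hn.ne'⟩
  have hn' : (0 : ℝ) < n := by exact_mod_cast hn
  have h3 : (#{w : Fin n → ι | 0 ≤ ∑ i, A (w i)} : ℝ) ≤ n * hlineCount A n := by
    exact_mod_cast card_sum_nonneg_le_mul_hlineCount A n
  have h4 : n * c ^ n ≤ L ^ n / 2 := by
    rw [div_pow, ← mul_div_assoc, div_le_iff₀ (by positivity)] at h2
    linarith
  have h5 : c ^ n ≤ (hlineCount A n : ℝ) :=
    le_of_mul_le_mul_left (h4.trans (h1.trans h3)) hn'
  calc c = (c ^ n) ^ ((n : ℝ)⁻¹) := (Real.pow_rpow_inv_natCast hc0.le hn.ne').symm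
    _ ≤ _ := Real.rpow_le_rpow (by positivity) h5 (by positivity)

/-- For a finite nontrivial multiset `A` of reals with drift `δ(A) < 0`,
the growth constant of the half-line walk counting sequence equals `χ_A(τ_A)`,
where `τ_A` is the unique positive real with `χ_A'(τ_A) = 0`. -/
theorem halfline_growth_of_neg_drift {ι : Type} [Fintype ι] (A : ι → ℝ)
    (hpos : ∃ k, 0 < A k) (hneg : ∃ k, A k < 0)
    (hdrift : (∑ k, A k) < 0)
    (τ : ℝ) (hτpos : 0 < τ) (hτcrit : deriv (chi A) τ = 0)
    (hτuniq : ∀ u : ℝ, 0 < u → deriv (chi A) u = 0 → u = τ) :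
    walkGrowth (hlineCount A) = chi A τ := by
  have : Nonempty ι := ⟨hpos.choose⟩
  have hcrit := sum_mul_rpow_eq_zero_of_deriv_chi A hτpos hτcrit
  have hτ1 : 1 < τ := by
    by_contra! h
    have : ∑ k, A k * τ ^ A k ≤ ∑ k, A k * (1 : ℝ) ^ A k :=
      sum_le_sum fun k _ => mul_rpow_self_le hτpos h
    simp only [Real.one_rpow, mul_one] at this
    linarith
  have hχ := chi_pos A hτpos
  refine Tendsto.limsup_eq (tendsto_order.2 ⟨fun c hc => ?_, fun c hc => ?_⟩)
  · obtain ⟨d, hd, hdχ⟩ := exists_between (max_lt hc hχ)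
    have hmτ : tiltedMean A τ = 0 := by rw [tiltedMean, hcrit, zero_div]
    have hcont : ContinuousAt (fun u => chi A u * u ^ (-(2 * tiltedMean A u))) τ :=
      (continuousAt_chi A hτpos).mul (continuousAt_id.rpow
        ((continuousAt_tiltedMean A hτpos).const_mul 2).neg (Or.inl hτpos.ne'))
    have hnear : ∀ᶠ u in 𝓝[>] τ, d < chi A u * u ^ (-(2 * tiltedMean A u)) :=
      (hcont.eventually (lt_mem_nhds (by simpa [hmτ] using hdχ))).filter_mono nhdsWithin_le_nhds
    obtain ⟨u, hdu, huτ⟩ := (hnear.and self_mem_nhdsWithin).exists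
    have hmu : 0 < tiltedMean A u := by
      refine div_pos ?_ (chi_pos A (hτpos.trans huτ))
      have := sum_mul_rpow_lt A hpos hτpos huτ
      linarith
    filter_upwards [eventually_le_hlineCount_rpow A (hτ1.trans huτ).le hmu
      ((le_max_right _ _).trans_lt hd) hdu] with n hn
    exact ((le_max_left _ _).trans_lt hd).trans_le hn
  · filter_upwards [eventually_gt_atTop 0] with n hn
    refine lt_of_le_of_lt ?_ hc
    calc (hlineCount A n : ℝ) ^ ((n : ℝ)⁻¹) ≤ (chi A τ ^ n) ^ ((n : ℝ)⁻¹) :=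
          Real.rpow_le_rpow (Nat.cast_nonneg _) (hlineCount_le_chi_pow A hτ1.le n) (by positivity)
      _ = chi A τ := Real.pow_rpow_inv_natCast hχ.le hn.ne'
end

section
/- (Rotation Lemma) Let S and T be finite multisets of vectors in ℤ² defining quarter-plane models, and suppose T is obtained from S by replacing a single step (i, j) ∈ S with the step (i + 1, j) (that is, S \ T = {(i,j)} and T \ S = {(i+1, j)} as multisets). Then for every n the number of quarter-plane walks satisfies q_n(S) ≤ q_n(T), and consequently K_S ≤ K_T. The same holds when the replacement step is (i, j+1) instead of (i+1, j). -/
open scoped BigOperators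

/-- `w` is a walk on the step multiset `S` staying in the region `R`:
every partial sum of its steps lies in `R`. -/
def IsWalkIn {ι : Type} (S : ι → ℤ × ℤ) (R : Set (ℝ × ℝ)) {n : ℕ} (w : Fin n → ι) : Prop :=
  ∀ m : Fin n,
    ((∑ i : Fin n, if i ≤ m then ((S (w i)).1 : ℝ) else 0),
     (∑ i : Fin n, if i ≤ m then ((S (w i)).2 : ℝ) else 0)) ∈ R

/-- The number of walks of length `n` on `S` staying in the region `R`. -/
noncomputable def walkCount {ι : Type} [Fintype ι] (S : ι → ℤ × ℤ) (R : Set (ℝ × ℝ))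
    (n : ℕ) : ℕ :=
  Nat.card {w : Fin n → ι // IsWalkIn S R w}

/-- The half-plane `H_θ = {(x,y) : x sin θ + y cos θ ≥ 0}`. -/
def Hplane (θ : ℝ) : Set (ℝ × ℝ) := {p | 0 ≤ p.1 * Real.sin θ + p.2 * Real.cos θ}

/-- The first quadrant `Q = [0,∞)²`. -/
def Quadrant : Set (ℝ × ℝ) := {p : ℝ × ℝ | 0 ≤ p.1 ∧ 0 ≤ p.2}

/-- The projected unidimensional multiset `A(θ) = {i sin θ + j cos θ : (i,j) ∈ S}`. -/
noncomputable def Atheta {ι : Type} (S : ι → ℤ × ℤ) (θ : ℝ) : ι → ℝ :=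
  fun k => ((S k).1 : ℝ) * Real.sin θ + ((S k).2 : ℝ) * Real.cos θ

/-- If every step of `T` dominates the corresponding step of `S`, then every quadrant walk on `S`
is also a quadrant walk on `T`. -/
theorem IsWalkIn.quadrant_mono {ι : Type} {S T : ι → ℤ × ℤ} (h : S ≤ T) {n : ℕ} {w : Fin n → ι}
    (hw : IsWalkIn S Quadrant w) : IsWalkIn T Quadrant w := by
  intro m
  refine ⟨(hw m).1.trans ?_, (hw m).2.trans ?_⟩
  · dsimp only
    refine Finset.sum_le_sum fun i _ => ?_
    split_ifs
    · exact_mod_cast (h (w i)).1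
    · rfl
  · dsimp only
    refine Finset.sum_le_sum fun i _ => ?_
    split_ifs
    · exact_mod_cast (h (w i)).2
    · rfl

theorem walkCount_quadrant_mono {ι : Type} [Fintype ι] {S T : ι → ℤ × ℤ} (h : S ≤ T) (n : ℕ) :
    walkCount S Quadrant n ≤ walkCount T Quadrant n :=
  Nat.card_le_card_of_injective (Subtype.map id fun _ hw => IsWalkIn.quadrant_mono h hw)
    (Subtype.map_injective _ Function.injective_id)

theorem walkCount_le_card_pow {ι : Type} [Fintype ι] (S : ι → ℤ × ℤ) (R : Set (ℝ × ℝ)) (n : ℕ) :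
    walkCount S R n ≤ Fintype.card ι ^ n := by
  refine (Nat.card_le_card_of_injective _ Subtype.val_injective).trans_eq ?_
  simp

/-- The growth constant is monotone among sequences of at most exponential growth. -/
theorem walkGrowth_mono {f g : ℕ → ℕ} (hfg : ∀ n, f n ≤ g n) {C : ℕ} (hg : ∀ n, g n ≤ C ^ n) :
    walkGrowth f ≤ walkGrowth g := by
  refine Filter.limsup_le_limsup (Filter.Eventually.of_forall fun n => ?_) ?_ ?_
  · exact Real.rpow_le_rpow (Nat.cast_nonneg _) (by exact_mod_cast hfg n) (by positivity)
  · exact Filter.IsCoboundedUnder.of_frequently_ge (a := 0)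
      (Filter.Frequently.of_forall fun n => by positivity)
  · refine Filter.isBoundedUnder_of_eventually_le (a := (C : ℝ)) ?_
    filter_upwards [Filter.eventually_ne_atTop 0] with n hn
    calc (g n : ℝ) ^ ((n : ℝ)⁻¹) ≤ ((C : ℝ) ^ n) ^ ((n : ℝ)⁻¹) :=
          Real.rpow_le_rpow (Nat.cast_nonneg _) (by exact_mod_cast hg n) (by positivity)
      _ = C := Real.pow_rpow_inv_natCast (Nat.cast_nonneg _) hn

/-- **Rotation Lemma.** Let `S` and `T` be finite multisets of steps in
`ℤ²` such that `T` is obtained from `S` by replacing the single step `S k₀ = (i,j)` with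
`(i+1, j)` (or with `(i, j+1)`), all other steps being equal. Then
`q_n(S) ≤ q_n(T)` for every `n`, and consequently `K_S ≤ K_T`. -/
theorem rotation_lemma {ι : Type} [Fintype ι] (S T : ι → ℤ × ℤ) (k₀ : ι)
    (hsame : ∀ k, k ≠ k₀ → T k = S k)
    (hrot : T k₀ = ((S k₀).1 + 1, (S k₀).2) ∨ T k₀ = ((S k₀).1, (S k₀).2 + 1)) :
    (∀ n : ℕ, walkCount S Quadrant n ≤ walkCount T Quadrant n) ∧
    walkGrowth (walkCount S Quadrant) ≤ walkGrowth (walkCount T Quadrant) := by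
  have h : S ≤ T := by
    intro k
    by_cases hk : k = k₀
    · subst hk
      rcases hrot with h | h <;> rw [h, Prod.le_def] <;> simp
    · exact (hsame k hk).ge
  have hcount := walkCount_quadrant_mono h
  exact ⟨hcount, walkGrowth_mono hcount (walkCount_le_card_pow T Quadrant)⟩
end
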